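/- arXiv:math/0608126 — 4 statements merged into one kernel-verified Lean document; each statement's English description precedes it below -/
import Mathlib

section
/- Let G be a finite group, g a finite abelian additive group, and exp : g → G a bijection with inverse log. Assume (i) for each a ∈ G the map Ad a : g → g, x ↦ log(a · exp(x) · a⁻¹), is additive (hence an automorphism of g); and (ii) for all class functions F₁, F₂ : G → ℂ one has (F₁ * F₂) ∘ exp = (F₁ ∘ exp) ⋆ (F₂ ∘ exp), where * and ⋆ are the normalized convolutions on G and g respectively. Let G act on ĝ by (a · f)(x) = f((Ad a)⁻¹(x)). Then the assignment sending a G-orbit Ω ⊆ ĝ to the function χ_Ω : G → ℂ defined by χ_Ω(exp x) = |Ω|^{−1/2} · ∑_{f ∈ Ω} f(x) is a well-defined bijection from the set of G-orbits in ĝ onto the set of characters of irreducible complex representations of G (the character of a representation ρ being g ↦ trace ρ(g)). -/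
/-- A class function on a group. -/
def IsClassFun {G : Type*} [Group G] (F : G → ℂ) : Prop :=
  ∀ h γ : G, F (h * γ * h⁻¹) = F γ

/-- Normalized convolution of functions on a finite group:
`(F₁ * F₂)(γ) = |G|⁻¹ ∑_h F₁(h) F₂(h⁻¹ γ)`. -/
noncomputable def convG {G : Type*} [Group G] [Fintype G] (F₁ F₂ : G → ℂ) : G → ℂ :=
  fun γ => (Fintype.card G : ℂ)⁻¹ * ∑ h : G, F₁ h * F₂ (h⁻¹ * γ)

/-- Normalized convolution of functions on a finite abelian additive group:
`(u ⋆ v)(z) = |g|⁻¹ ∑_x u(x) v(z − x)`. -/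
noncomputable def convA {g : Type*} [AddCommGroup g] [Fintype g] (u v : g → ℂ) : g → ℂ :=
  fun z => (Fintype.card g : ℂ)⁻¹ * ∑ x : g, u x * v (z - x)

/-- A character of a finite abelian additive group `g`, i.e. an element of `ĝ`:
a function `g → ℂ` which is a homomorphism into `ℂˣ`. -/
def IsAddCharFun {g : Type*} [AddCommGroup g] (f : g → ℂ) : Prop :=
  f 0 = 1 ∧ ∀ x y : g, f (x + y) = f x * f y

/-- `Ω ⊆ ĝ` is an orbit of the action of `G` on `ĝ` given by `(a · f)(x) = f((Ad a)⁻¹ x)`. -/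
def IsOrbit {G g : Type*} [Group G] [AddCommGroup g] (Ad : G → g ≃+ g)
    (Ω : Set (g → ℂ)) : Prop :=
  ∃ f : g → ℂ, IsAddCharFun f ∧ Ω = { f' | ∃ a : G, f' = fun x => f ((Ad a).symm x) }

/-- Irreducibility of a (matrix) representation `ρ : G →* GL_n(ℂ)`: the space is nonzero
and has no nontrivial invariant subspaces. -/
def RepIrred {G : Type*} [Group G] {n : ℕ}
    (ρ : G →* Matrix.GeneralLinearGroup (Fin n) ℂ) : Prop :=
  0 < n ∧ ∀ W : Submodule ℂ (Fin n → ℂ),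
    (∀ γ : G, ∀ v ∈ W, (ρ γ).val.mulVec v ∈ W) → W = ⊥ ∨ W = ⊤

/-- `χ` is the character of an irreducible complex representation of `G`. -/
def IsIrredChar {G : Type*} [Group G] (χ : G → ℂ) : Prop :=
  ∃ (n : ℕ) (ρ : G →* Matrix.GeneralLinearGroup (Fin n) ℂ),
    RepIrred ρ ∧ ∀ γ : G, χ γ = Matrix.trace (ρ γ).val

/-- The function `χ_Ω : G → ℂ` determined by `χ_Ω(exp x) = |Ω|^{-1/2} ∑_{f ∈ Ω} f(x)`. -/
noncomputable def chiOrb {G g : Type*} (exp : g ≃ G) (Ω : Set (g → ℂ)) : G → ℂ :=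
  fun γ => ((Real.sqrt (Nat.card ↥Ω) : ℂ))⁻¹ * ∑ᶠ f ∈ Ω, f (exp.symm γ)

theorem sum_smul_mul_comm {G : Type*} [Group G] [Fintype G] {n : ℕ}
    (ρ : G →* Matrix.GeneralLinearGroup (Fin n) ℂ) {F : G → ℂ} (hF : IsClassFun F) (γ : G) :
    (∑ h, F h • (ρ h).val) * (ρ γ).val = (ρ γ).val * ∑ h, F h • (ρ h).val := by
  rw [Finset.sum_mul, Finset.mul_sum, ← Equiv.sum_comp (MulAut.conj γ).toEquiv]
  refine Finset.sum_congr rfl fun h _ ↦ ?_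
  have : (ρ (γ * h * γ⁻¹)).val * (ρ γ).val = (ρ γ).val * (ρ h).val := by
    rw [← Units.val_mul, ← Units.val_mul, ← map_mul, ← map_mul]; simp
  simp [MulAut.conj_apply, hF γ h, this, -map_mul]

namespace RepIrred

variable {G : Type*} [Group G] {n : ℕ} {ρ : G →* Matrix.GeneralLinearGroup (Fin n) ℂ}

/-- **Schur's lemma** for irreducible matrix representations. -/
theorem eq_smul_one_of_commute (hρ : RepIrred ρ) {T : Matrix (Fin n) (Fin n) ℂ}
    (hT : ∀ γ, T * (ρ γ).val = (ρ γ).val * T) : ∃ c : ℂ, T = c • 1 := by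
  have : NeZero n := ⟨hρ.1.ne'⟩
  obtain ⟨c, hc⟩ := Module.End.exists_eigenvalue (Matrix.toLin' T)
  have hW := hρ.2 (Module.End.eigenspace (Matrix.toLin' T) c) fun γ v hv ↦ by
    rw [Module.End.mem_eigenspace_iff, Matrix.toLin'_apply] at hv ⊢
    rw [Matrix.mulVec_mulVec, hT, ← Matrix.mulVec_mulVec, hv, Matrix.mulVec_smul]
  have hW := hW.resolve_left hc
  refine ⟨c, Matrix.toLin'.injective (LinearMap.ext fun v ↦ ?_)⟩
  have hv : v ∈ Module.End.eigenspace (Matrix.toLin' T) c := hW ▸ Submodule.mem_top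
  simpa [Matrix.toLin'_apply, Matrix.smul_mulVec] using Module.End.mem_eigenspace_iff.1 hv

theorem natCast_smul_eq_trace_smul_one (hρ : RepIrred ρ) {T : Matrix (Fin n) (Fin n) ℂ}
    (hT : ∀ γ, T * (ρ γ).val = (ρ γ).val * T) : (n : ℂ) • T = T.trace • 1 := by
  obtain ⟨c, rfl⟩ := hρ.eq_smul_one_of_commute hT
  simp [Matrix.trace_smul, Matrix.trace_one, smul_smul, mul_comm]

variable [Fintype G]

/-- First orthogonality relation: an irreducible character has norm one. -/
theorem sum_trace_mul_trace_inv (hρ : RepIrred ρ) :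
    ∑ h : G, (ρ h).val.trace * (ρ h⁻¹).val.trace = Fintype.card G := by
  have hn : (n : ℂ) ≠ 0 := by exact_mod_cast hρ.1.ne'
  have key (i j : Fin n) :
      ∑ h : G, (ρ h).val i i * (ρ h⁻¹).val j j = if i = j then (Fintype.card G : ℂ) / n else 0 := by
    set T : Matrix (Fin n) (Fin n) ℂ :=
      ∑ h : G, (ρ h).val * Matrix.single i j 1 * (ρ h⁻¹).val with hTdef
    have hT : (n : ℂ) • T = T.trace • 1 := by
      refine hρ.natCast_smul_eq_trace_smul_one fun γ ↦ ?_
      rw [hTdef, Finset.sum_mul, Finset.mul_sum, ← Equiv.sum_comp (Equiv.mulLeft γ)]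
      refine Finset.sum_congr rfl fun h _ ↦ ?_
      have h1 : (ρ (γ * h)).val = (ρ γ).val * (ρ h).val := by simp
      have h2 : (ρ (γ * h)⁻¹).val * (ρ γ).val = (ρ h⁻¹).val := by
        rw [← Units.val_mul, ← map_mul]; simp
      simp only [Equiv.coe_mulLeft, mul_assoc, h2]
      rw [h1]; simp only [mul_assoc]
    have htr : T.trace = if i = j then (Fintype.card G : ℂ) else 0 := by
      rw [hTdef, Matrix.trace_sum]
      have (h : G) : ((ρ h).val * Matrix.single i j 1 * (ρ h⁻¹).val).trace
          = if i = j then (1 : ℂ) else 0 := by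
        rw [Matrix.mul_assoc, Matrix.trace_mul_comm, Matrix.mul_assoc, ← Units.val_mul,
          ← map_mul]
        split_ifs with h
        · simp [h]
        · simp [Matrix.trace_single_eq_of_ne _ _ _ h]
      simp only [this]
      split_ifs <;> simp
    have hij := congr_fun₂ hT i j
    have hTij : T i j = ∑ h : G, (ρ h).val i i * (ρ h⁻¹).val j j := by
      rw [hTdef, Matrix.sum_apply]
      refine Finset.sum_congr rfl fun h _ ↦ ?_
      simp [Matrix.mul_apply, Matrix.single_apply, ite_and]
    rw [← hTij]
    rw [htr, Matrix.smul_apply, Matrix.smul_apply, Matrix.one_apply] at hij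
    split_ifs at hij ⊢ with h
    · rw [eq_div_iff hn]; simpa [mul_comm] using hij
    · simpa [hn] using hij
  calc ∑ h : G, (ρ h).val.trace * (ρ h⁻¹).val.trace
      = ∑ i, ∑ j, ∑ h : G, (ρ h).val i i * (ρ h⁻¹).val j j := by
        simp only [Matrix.trace, Matrix.diag, Finset.sum_mul_sum]
        rw [Finset.sum_comm]
        exact Finset.sum_congr rfl fun i _ ↦ Finset.sum_comm
    _ = Fintype.card G := by
        simp only [key, Finset.sum_ite_eq, Finset.mem_univ, if_true, Finset.sum_const,
          Finset.card_univ, Fintype.card_fin, nsmul_eq_mul]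
        field_simp

/-- On class functions, the central character of an irreducible representation turns
convolution into multiplication. -/
theorem sum_mul_trace_mul_sum_mul_trace (hρ : RepIrred ρ) {F₁ F₂ : G → ℂ}
    (h₁ : IsClassFun F₁) :
    (∑ h, F₁ h * (ρ h).val.trace) * ∑ h, F₂ h * (ρ h).val.trace
      = n * Fintype.card G * ∑ h, convG F₁ F₂ h * (ρ h).val.trace := by
  have hG : (Fintype.card G : ℂ) ≠ 0 := by exact_mod_cast Fintype.card_ne_zero
  set M : (G → ℂ) → Matrix (Fin n) (Fin n) ℂ := fun F ↦ ∑ h, F h • (ρ h).val with hM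
  have htr (F : G → ℂ) : (M F).trace = ∑ h, F h * (ρ h).val.trace := by
    simp [hM, Matrix.trace_sum, Matrix.trace_smul]
  have hcomm : ∀ γ, M F₁ * (ρ γ).val = (ρ γ).val * M F₁ := sum_smul_mul_comm ρ h₁
  have hconv : (Fintype.card G : ℂ) • M (convG F₁ F₂) = M F₁ * M F₂ := by
    simp only [hM, convG, Finset.smul_sum, smul_smul, mul_inv_cancel_left₀ hG,
      Finset.sum_mul_sum, Finset.sum_smul]
    rw [Finset.sum_comm]
    refine Finset.sum_congr rfl fun h _ ↦ ?_
    rw [← Equiv.sum_comp (Equiv.mulLeft h)]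
    refine Finset.sum_congr rfl fun k _ ↦ ?_
    simp [smul_smul, mul_comm]
  rw [← htr, ← htr, ← htr, mul_assoc, ← smul_eq_mul (Fintype.card G : ℂ), ← Matrix.trace_smul,
    hconv, ← smul_eq_mul (n : ℂ), ← Matrix.trace_smul, ← smul_mul_assoc,
    hρ.natCast_smul_eq_trace_smul_one hcomm]
  simp [Matrix.trace_smul]

end RepIrred

/-- A nonzero function on a finite group acts nontrivially in some irreducible representation. -/
theorem exists_repIrred_sum_smul_ne_zero {G : Type*} [Group G] [Fintype G] {F : G → ℂ}
    (hF : F ≠ 0) : ∃ (n : ℕ) (ρ : G →* Matrix.GeneralLinearGroup (Fin n) ℂ),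
      RepIrred ρ ∧ ∑ h, F h • (ρ h).val ≠ 0 := by
  classical
  set e : MonoidAlgebra ℂ G := ∑ h, F h • MonoidAlgebra.of ℂ G h with he
  have he0 : e ≠ 0 := fun h0 ↦ hF <| funext fun k ↦ by
    have := congr_arg (fun a : MonoidAlgebra ℂ G ↦ a.coeff k) h0
    simpa [he, MonoidAlgebra.coeff_sum, Finsupp.finsetSum_apply, Finsupp.single_apply] using this
  have hjac : Ring.jacobson (MonoidAlgebra ℂ G) = ⊥ := IsSemisimpleModule.jacobson_eq_bot _ _
  obtain ⟨I, hI, heI⟩ : ∃ I : Ideal (MonoidAlgebra ℂ G), I.IsMaximal ∧ e ∉ I := by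
    by_contra! hall
    refine he0 ((Submodule.mem_bot (MonoidAlgebra ℂ G)).1 ?_)
    rw [← hjac, Ring.jacobson_eq_sInf_isMaximal]
    exact Submodule.mem_sInf.2 hall
  have : IsSimpleModule (MonoidAlgebra ℂ G) (MonoidAlgebra ℂ G ⧸ I) := isSimpleModule_iff_isCoatom.2 hI.out
  have : Module.Finite ℂ (MonoidAlgebra ℂ G) := Module.Finite.equiv (MonoidAlgebra.coeffLinearEquiv ℂ).symm
  have : Nontrivial (MonoidAlgebra ℂ G ⧸ I) := IsSimpleModule.nontrivial (MonoidAlgebra ℂ G) _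
  have : Module.Finite ℂ (MonoidAlgebra ℂ G ⧸ I) := inferInstance
  let b := Module.finBasis ℂ (MonoidAlgebra ℂ G ⧸ I)
  let Φ : MonoidAlgebra ℂ G →ₐ[ℂ] Matrix _ _ ℂ :=
    (LinearMap.toMatrixAlgEquiv b).toAlgHom.comp (Algebra.lsmul ℂ ℂ (MonoidAlgebra ℂ G ⧸ I))
  let ρ := (Φ.toMonoidHom.comp (MonoidAlgebra.of ℂ G)).toHomUnits
  have hρ (h : G) : (ρ h).val = Φ (MonoidAlgebra.of ℂ G h) := rfl
  have hact (a : MonoidAlgebra ℂ G) (v : MonoidAlgebra ℂ G ⧸ I) : (Φ a).mulVec (b.equivFun v) = b.equivFun (a • v) :=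
    LinearMap.toMatrix_mulVec_repr b b (Algebra.lsmul ℂ ℂ (MonoidAlgebra ℂ G ⧸ I) a) v
  refine ⟨_, ρ, ⟨Module.finrank_pos (R := ℂ) (M := MonoidAlgebra ℂ G ⧸ I), fun W hW ↦ ?_⟩, fun h0 ↦ heI ?_⟩
  · let N : Submodule (MonoidAlgebra ℂ G) (MonoidAlgebra ℂ G ⧸ I) := MonoidAlgebra.submoduleOfSMulMem
      (W.comap b.equivFun.toLinearMap) fun γ v hv ↦ by
        have := hW γ (b.equivFun v) hv
        rwa [hρ, hact] at this
    have hN (v : MonoidAlgebra ℂ G ⧸ I) : v ∈ N ↔ b.equivFun v ∈ W := Iff.rfl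
    refine (eq_bot_or_eq_top N).imp (fun h ↦ ?_) fun h ↦ ?_
    · refine (Submodule.eq_bot_iff W).2 fun w hw ↦ ?_
      have : b.equivFun.symm w ∈ N := by rwa [hN, LinearEquiv.apply_symm_apply]
      rwa [h, Submodule.mem_bot, LinearEquiv.map_eq_zero_iff] at this
    · refine Submodule.eq_top_iff'.2 fun w ↦ ?_
      have : b.equivFun.symm w ∈ N := h ▸ Submodule.mem_top
      rwa [hN, LinearEquiv.apply_symm_apply] at this
  · have hΦ : Φ e = 0 := by simpa only [he, hρ, map_sum, map_smul] using h0
    have := hact e (Submodule.Quotient.mk 1)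
    rw [hΦ, Matrix.zero_mulVec, eq_comm, LinearEquiv.map_eq_zero_iff, ← Submodule.Quotient.mk_smul,
      Submodule.Quotient.mk_eq_zero] at this
    simpa using this

/-- Fourier coefficient (unnormalized) of a function on a finite abelian group. -/
noncomputable def addCharCoeff {g : Type*} [AddCommGroup g] [Fintype g] (u : g → ℂ)
    (ψ : AddChar g ℂ) : ℂ :=
  ∑ x, u x * ψ (-x)

section Fourier

variable {g : Type*} [AddCommGroup g] [Fintype g]

theorem addCharCoeff_addChar (φ ψ : AddChar g ℂ) [Decidable (φ = ψ)] :
    addCharCoeff φ ψ = if φ = ψ then (Fintype.card g : ℂ) else 0 := by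
  classical
  have := AddChar.sum_eq_ite (φ * ψ⁻¹)
  have h0 : φ * ψ⁻¹ = 0 ↔ φ = ψ := mul_inv_eq_one
  simpa [addCharCoeff, AddChar.inv_apply, h0] using this

theorem addCharCoeff_sum (T : Finset (AddChar g ℂ)) (c : ℂ) (ψ : AddChar g ℂ) [Decidable (ψ ∈ T)] :
    addCharCoeff (fun x ↦ c * ∑ φ ∈ T, φ x) ψ = if ψ ∈ T then c * Fintype.card g else 0 := by
  classical
  calc addCharCoeff (fun x ↦ c * ∑ φ ∈ T, φ x) ψ = c * ∑ φ ∈ T, addCharCoeff φ ψ := by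
        simp only [addCharCoeff, Finset.mul_sum, Finset.sum_mul, mul_assoc]
        exact Finset.sum_comm
    _ = _ := by simp [addCharCoeff_addChar]

theorem sum_addCharCoeff_mul (u : g → ℂ) (x : g) :
    ∑ ψ : AddChar g ℂ, addCharCoeff u ψ * ψ x = Fintype.card g * u x := by
  classical
  have h (y : g) : ∑ ψ : AddChar g ℂ, ψ (-y) * ψ x = if y = x then (Fintype.card g : ℂ) else 0 := by
    simp only [← AddChar.map_add_eq_mul, AddChar.sum_apply_eq_ite, neg_add_eq_zero]
  simp only [addCharCoeff, Finset.sum_mul, mul_assoc]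
  rw [Finset.sum_comm]
  simp only [← Finset.mul_sum, h]
  simp [mul_comm]

theorem convA_smul_sum_addChar [DecidableEq (AddChar g ℂ)] (S T : Finset (AddChar g ℂ)) (c d : ℂ) :
    convA (fun x ↦ c * ∑ φ ∈ S, φ x) (fun x ↦ d * ∑ φ ∈ T, φ x)
      = fun z ↦ c * d * ∑ φ ∈ S ∩ T, φ z := by
  have hg : (Fintype.card g : ℂ) ≠ 0 := by exact_mod_cast Fintype.card_ne_zero
  funext z
  have h (φ ψ : AddChar g ℂ) :
      ∑ x, φ x * ψ (z - x) = if φ = ψ then Fintype.card g * ψ z else 0 := by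
    calc ∑ x, φ x * ψ (z - x) = ψ z * addCharCoeff φ ψ := by
          simp only [addCharCoeff, Finset.mul_sum, sub_eq_add_neg, AddChar.map_add_eq_mul]
          exact Finset.sum_congr rfl fun x _ ↦ by ring
      _ = _ := by rw [addCharCoeff_addChar]; split_ifs <;> ring
  calc convA (fun x ↦ c * ∑ φ ∈ S, φ x) (fun x ↦ d * ∑ φ ∈ T, φ x) z
      = (Fintype.card g : ℂ)⁻¹ * (c * d * ∑ φ ∈ S, ∑ ψ ∈ T, ∑ x, φ x * ψ (z - x)) := by
        rw [convA]
        congr 1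
        simp only [mul_mul_mul_comm c, ← Finset.mul_sum]
        congr 1
        simp only [Finset.sum_mul_sum]
        rw [Finset.sum_comm]
        exact Finset.sum_congr rfl fun φ _ ↦ Finset.sum_comm
    _ = _ := by
        simp only [h, Finset.sum_ite_eq, ← Finset.sum_filter, Finset.filter_mem_eq_inter,
          ← Finset.mul_sum]
        field_simp

theorem convA_comp_neg (u v : g → ℂ) (z : g) :
    convA (fun x ↦ u (-x)) (fun x ↦ v (-x)) z = convA u v (-z) := by
  simp only [convA]
  rw [← Equiv.sum_comp (Equiv.neg g)]
  simp [sub_eq_add_neg, add_comm]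

theorem sum_sum_addChar_mul {G : Type*} [Fintype G] (exp : g ≃ G) (T : Finset (AddChar g ℂ))
    (χ : G → ℂ) :
    ∑ h, (∑ φ ∈ T, φ (-exp.symm h)) * χ h = ∑ φ ∈ T, addCharCoeff (fun x ↦ χ (exp x)) φ := by
  rw [← Equiv.sum_comp exp]
  simp only [addCharCoeff, Equiv.symm_apply_apply, Finset.sum_mul]
  rw [Finset.sum_comm]
  simp only [mul_comm]

end Fourier

theorem chiOrb_image {G g : Type*} [AddCommGroup g] (exp : g ≃ G) (T : Finset (AddChar g ℂ)) :
    chiOrb exp ((⇑) '' (T : Set (AddChar g ℂ)))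
      = fun γ ↦ ((Real.sqrt T.card : ℂ))⁻¹ * ∑ φ ∈ T, φ (exp.symm γ) := by
  funext γ
  rw [chiOrb, Nat.card_image_of_injective DFunLike.coe_injective,
    finsum_mem_image DFunLike.coe_injective.injOn, finsum_mem_coe_finset]
  simp

theorem Ad_symm_apply {G g : Type*} [Group G] [AddCommGroup g] {Ad : G → g ≃+ g}
    (hone : ∀ x, Ad 1 x = x) (hmul : ∀ a b x, Ad (a * b) x = Ad a (Ad b x)) (a : G) (x : g) :
    (Ad a).symm x = Ad a⁻¹ x := by
  rw [AddEquiv.symm_apply_eq, ← hmul, mul_inv_cancel, hone]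

/-- The orbit of an additive character under the coadjoint action `(a · ψ)(x) = ψ((Ad a)⁻¹ x)`. -/
noncomputable def coadjointOrbit {G g : Type*} [Finite G] [AddCommGroup g] (Ad : G → g ≃+ g)
    (ψ : AddChar g ℂ) : Finset (AddChar g ℂ) :=
  (Set.finite_range fun a ↦ ψ.compAddMonoidHom (Ad a).symm.toAddMonoidHom).toFinset

section Orbit

variable {G g : Type*} [Finite G] [AddCommGroup g] {Ad : G → g ≃+ g} {φ ψ : AddChar g ℂ}

theorem mem_coadjointOrbit : φ ∈ coadjointOrbit Ad ψ ↔ ∃ a, ∀ x, φ x = ψ ((Ad a).symm x) := by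
  simp [coadjointOrbit, DFunLike.ext_iff, eq_comm]

theorem isOrbit_iff {Ω : Set (g → ℂ)} [Group G] :
    IsOrbit Ad Ω ↔ ∃ ψ : AddChar g ℂ, Ω = (⇑) '' (coadjointOrbit Ad ψ : Set (AddChar g ℂ)) := by
  have key (ψ : AddChar g ℂ) : { f' | ∃ a : G, f' = fun x => ψ ((Ad a).symm x) }
      = (⇑) '' (coadjointOrbit Ad ψ : Set (AddChar g ℂ)) := by
    ext f
    constructor
    · rintro ⟨a, rfl⟩
      exact ⟨ψ.compAddMonoidHom (Ad a).symm.toAddMonoidHom,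
        mem_coadjointOrbit.2 ⟨a, fun _ ↦ rfl⟩, rfl⟩
    · rintro ⟨φ, hφ, rfl⟩
      obtain ⟨a, ha⟩ := mem_coadjointOrbit.1 hφ
      exact ⟨a, funext ha⟩
  constructor
  · rintro ⟨f, hf, rfl⟩
    exact ⟨⟨f, hf.1, hf.2⟩, key ⟨f, hf.1, hf.2⟩⟩
  · rintro ⟨ψ, rfl⟩
    exact ⟨ψ, ⟨ψ.map_zero_eq_one, ψ.map_add_eq_mul⟩, (key ψ).symm⟩

variable [Group G]

theorem mem_coadjointOrbit_self
    (hone : ∀ x, Ad 1 x = x) (hmul : ∀ a b x, Ad (a * b) x = Ad a (Ad b x)) : ψ ∈ coadjointOrbit Ad ψ :=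
  mem_coadjointOrbit.2 ⟨1, fun x ↦ by rw [Ad_symm_apply hone hmul, inv_one, hone]⟩

theorem mem_coadjointOrbit'
    (hone : ∀ x, Ad 1 x = x) (hmul : ∀ a b x, Ad (a * b) x = Ad a (Ad b x)) : φ ∈ coadjointOrbit Ad ψ ↔ ∃ a, ∀ x, φ x = ψ (Ad a x) := by
  simp only [mem_coadjointOrbit, Ad_symm_apply hone hmul]
  exact ((Equiv.inv G).surjective.exists (p := fun a ↦ ∀ x, φ x = ψ (Ad a x))).symm

theorem coadjointOrbit_eq_of_mem
    (hone : ∀ x, Ad 1 x = x) (hmul : ∀ a b x, Ad (a * b) x = Ad a (Ad b x))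
    (h : φ ∈ coadjointOrbit Ad ψ) :
    coadjointOrbit Ad φ = coadjointOrbit Ad ψ := by
  obtain ⟨a, ha⟩ := (mem_coadjointOrbit' hone hmul).1 h
  ext θ
  simp only [mem_coadjointOrbit' hone hmul, ha, ← hmul]
  exact ((Group.mulLeft_bijective a).surjective.exists (p := fun b ↦ ∀ x, θ x = ψ (Ad b x))).symm

theorem compAddMonoidHom_mem_coadjointOrbit
    (hone : ∀ x, Ad 1 x = x) (hmul : ∀ a b x, Ad (a * b) x = Ad a (Ad b x))
    (a : G) (h : φ ∈ coadjointOrbit Ad ψ) :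
    φ.compAddMonoidHom (Ad a).toAddMonoidHom ∈ coadjointOrbit Ad ψ := by
  rw [← coadjointOrbit_eq_of_mem hone hmul h, mem_coadjointOrbit' hone hmul]
  exact ⟨a, fun _ ↦ rfl⟩

theorem sum_coadjointOrbit_Ad
    (hone : ∀ x, Ad 1 x = x) (hmul : ∀ a b x, Ad (a * b) x = Ad a (Ad b x))
    (a : G) (x : g) :
    ∑ φ ∈ coadjointOrbit Ad ψ, φ (Ad a x) = ∑ φ ∈ coadjointOrbit Ad ψ, φ x := by
  refine Finset.sum_nbij' (fun φ ↦ φ.compAddMonoidHom (Ad a).toAddMonoidHom)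
    (fun φ ↦ φ.compAddMonoidHom (Ad a⁻¹).toAddMonoidHom)
    (fun φ ↦ compAddMonoidHom_mem_coadjointOrbit hone hmul a)
    (fun φ ↦ compAddMonoidHom_mem_coadjointOrbit hone hmul a⁻¹) (fun φ _ ↦ ?_) (fun φ _ ↦ ?_)
    fun φ _ ↦ rfl
  all_goals ext y; simp [← hmul, hone]

theorem isClassFun_sum_coadjointOrbit
    (hone : ∀ x, Ad 1 x = x) (hmul : ∀ a b x, Ad (a * b) x = Ad a (Ad b x))
    {exp : g ≃ G} (hexp : ∀ a x, exp (Ad a x) = a * exp x * a⁻¹)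
    (ψ : AddChar g ℂ) :
    IsClassFun fun γ ↦ ∑ φ ∈ coadjointOrbit Ad ψ, φ (-exp.symm γ) := fun h γ ↦ by
  have : exp.symm (h * γ * h⁻¹) = Ad h (exp.symm γ) := by
    rw [Equiv.symm_apply_eq, hexp, Equiv.apply_symm_apply]
  simp only [this, ← map_neg, sum_coadjointOrbit_Ad hone hmul]

theorem addCharCoeff_eq_of_mem
    (hone : ∀ x, Ad 1 x = x) (hmul : ∀ a b x, Ad (a * b) x = Ad a (Ad b x))
    [Fintype g] {u : g → ℂ} (hu : ∀ a x, u (Ad a x) = u x)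
    (h : φ ∈ coadjointOrbit Ad ψ) : addCharCoeff u φ = addCharCoeff u ψ := by
  obtain ⟨a, ha⟩ := (mem_coadjointOrbit' hone hmul).1 h
  rw [eq_comm, addCharCoeff, addCharCoeff, ← Equiv.sum_comp (Ad a).toEquiv]
  simp [ha, hu]

end Orbit

/-- If `exp : g ≃ G` intertwines the convolutions of class functions, it maps `0` to `1`. -/
theorem exp_zero_eq_one_of_convG_comp {G g : Type*} [Group G] [Fintype G] [AddCommGroup g]
    [Fintype g] (exp : g ≃ G)
    (hconv : ∀ F₁ F₂ : G → ℂ, IsClassFun F₁ → IsClassFun F₂ →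
      (fun x => convG F₁ F₂ (exp x)) = convA (fun x => F₁ (exp x)) (fun x => F₂ (exp x))) :
    exp 0 = 1 := by
  classical
  have hF : IsClassFun (fun γ : G ↦ if γ = 1 then (1 : ℂ) else 0) := fun h γ ↦ by
    simp [conj_eq_one_iff]
  have h := congr_fun (hconv _ _ hF hF) (exp.symm 1)
  by_contra h0
  have hR : convA (fun x ↦ if exp x = 1 then (1 : ℂ) else 0) (fun x ↦ if exp x = 1 then 1 else 0)
      (exp.symm 1) = 0 := by
    rw [convA, Finset.sum_eq_zero, mul_zero]
    intro x _
    by_cases hx : exp x = 1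
    · simp [← hx, Ne.symm (hx ▸ Ne.symm h0 : exp x ≠ exp 0)]
    · simp [hx]
  simp [hR, convG] at h

section Orbit

variable {G g : Type*} [Group G] [Fintype G] [AddCommGroup g] [Fintype g]
  {exp : g ≃ G} {Ad : G → g ≃+ g}

theorem RepIrred.exists_trace_eq_sum_coadjointOrbit
    (hone : ∀ x, Ad 1 x = x) (hmul : ∀ a b x, Ad (a * b) x = Ad a (Ad b x))
    (hexp : ∀ a x, exp (Ad a x) = a * exp x * a⁻¹)
    (hconv : ∀ F₁ F₂ : G → ℂ, IsClassFun F₁ → IsClassFun F₂ →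
      (fun x => convG F₁ F₂ (exp x)) = convA (fun x => F₁ (exp x)) (fun x => F₂ (exp x)))
    {n : ℕ} {ρ : G →* Matrix.GeneralLinearGroup (Fin n) ℂ} (hρ : RepIrred ρ) :
    ∃ ψ : AddChar g ℂ, ∀ x, (ρ (exp x)).val.trace
      = (Real.sqrt (coadjointOrbit Ad ψ).card : ℂ)⁻¹ * ∑ φ ∈ coadjointOrbit Ad ψ, φ x := by
  classical
  have hg : (Fintype.card g : ℂ) ≠ 0 := by exact_mod_cast Fintype.card_ne_zero
  have hG : (Fintype.card G : ℂ) ≠ 0 := by exact_mod_cast Fintype.card_ne_zero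
  have hn : (n : ℂ) ≠ 0 := by exact_mod_cast hρ.1.ne'
  have hexp0 : exp 0 = 1 := exp_zero_eq_one_of_convG_comp exp hconv
  set χ : G → ℂ := fun γ ↦ (ρ γ).val.trace with hχ
  set u : g → ℂ := fun x ↦ χ (exp x) with hu
  have hχclass : IsClassFun χ := fun h γ ↦ by
    simp only [hχ, map_mul, Units.val_mul]
    rw [Matrix.trace_mul_comm, ← Matrix.mul_assoc, ← Units.val_mul, ← map_mul]
    simp
  have hu0 : u 0 = n := by simp [hu, hχ, hexp0]
  have huclass (a : G) (x : g) : u (Ad a x) = u x := by simp only [hu, hexp, hχclass a]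
  -- The functions `E ψ` are pairwise orthogonal for convolution.
  set E : AddChar g ℂ → G → ℂ := fun ψ γ ↦ ∑ φ ∈ coadjointOrbit Ad ψ, φ (-exp.symm γ) with hE
  have hEclass (ψ : AddChar g ℂ) : IsClassFun (E ψ) :=
    isClassFun_sum_coadjointOrbit hone hmul hexp ψ
  have hEχ (ψ : AddChar g ℂ) :
      ∑ h, E ψ h * χ h = (coadjointOrbit Ad ψ).card * addCharCoeff u ψ := by
    rw [sum_sum_addChar_mul, ← nsmul_eq_mul, ← Finset.sum_const]
    exact Finset.sum_congr rfl fun φ hφ ↦ addCharCoeff_eq_of_mem hone hmul huclass hφ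
  have hdisj {ψ θ : AddChar g ℂ} (h : θ ∉ coadjointOrbit Ad ψ) :
      addCharCoeff u ψ * addCharCoeff u θ = 0 := by
    have hST : coadjointOrbit Ad ψ ∩ coadjointOrbit Ad θ = ∅ := by
      refine Finset.eq_empty_of_forall_notMem fun φ hφ ↦ h ?_
      obtain ⟨h₁, h₂⟩ := Finset.mem_inter.1 hφ
      rw [← coadjointOrbit_eq_of_mem hone hmul h₁, coadjointOrbit_eq_of_mem hone hmul h₂]
      exact mem_coadjointOrbit_self hone hmul
    have hzero : convG (E ψ) (E θ) = 0 := by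
      funext γ
      have h₁ := congr_fun (hconv _ _ (hEclass ψ) (hEclass θ)) (exp.symm γ)
      simp only [hE, Equiv.symm_apply_apply, Equiv.apply_symm_apply] at h₁
      rw [h₁, convA_comp_neg (fun x ↦ ∑ φ ∈ coadjointOrbit Ad ψ, φ x)
        (fun x ↦ ∑ φ ∈ coadjointOrbit Ad θ, φ x)]
      simpa [hST] using congr_fun
        (convA_smul_sum_addChar (coadjointOrbit Ad ψ) (coadjointOrbit Ad θ) 1 1) (-exp.symm γ)
    have h₂ := hρ.sum_mul_trace_mul_sum_mul_trace (F₂ := E θ) (hEclass ψ)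
    rw [hzero, hEχ, hEχ] at h₂
    have hcard (ψ : AddChar g ℂ) : ((coadjointOrbit Ad ψ).card : ℂ) ≠ 0 := by
      exact_mod_cast (Finset.card_pos.2 ⟨ψ, mem_coadjointOrbit_self hone hmul⟩).ne'
    simpa [hcard] using h₂
  obtain ⟨ψ, hψ⟩ : ∃ ψ, addCharCoeff u ψ ≠ 0 := by
    by_contra! hall
    have := sum_addCharCoeff_mul u 0
    simp [hall, hu0, hn] at this
  set O := coadjointOrbit Ad ψ with hO
  obtain ⟨c, hc⟩ : ∃ c, u = fun x ↦ c * ∑ φ ∈ O, φ x := by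
    refine ⟨(Fintype.card g : ℂ)⁻¹ * addCharCoeff u ψ, funext fun x ↦ ?_⟩
    have h₁ : ∑ φ ∈ O, addCharCoeff u φ * φ x = ∑ φ, addCharCoeff u φ * φ x :=
      Finset.sum_subset (Finset.subset_univ _) fun φ _ hφ ↦ by
        rw [(mul_eq_zero.1 (hdisj hφ)).resolve_left hψ, zero_mul]
    rw [mul_assoc, Finset.mul_sum, eq_inv_mul_iff_mul_eq₀ hg, ← sum_addCharCoeff_mul, ← h₁]
    exact Finset.sum_congr rfl fun φ hφ ↦ by rw [addCharCoeff_eq_of_mem hone hmul huclass hφ]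
  have hdeg : (n : ℂ) = c * O.card := by
    rw [← hu0, hc]; simp
  have hnorm : c * c * O.card = 1 := by
    have h₁ := congr_fun (hconv _ _ hχclass hχclass) 0
    change convG χ χ (exp 0) = convA u u 0 at h₁
    rw [hc, convA_smul_sum_addChar, hexp0] at h₁
    simp only [convG, mul_one, hχ, hρ.sum_trace_mul_trace_inv, inv_mul_cancel₀ hG] at h₁
    simpa using h₁.symm
  have hsq : (O.card : ℝ) = (n : ℝ) ^ 2 := by
    have : (O.card : ℂ) = (n : ℂ) ^ 2 := by
      rw [hdeg]; linear_combination -(O.card : ℂ) * hnorm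
    exact_mod_cast this
  have hcn : c * n = 1 := by rw [hdeg]; linear_combination hnorm
  refine ⟨ψ, fun x ↦ ?_⟩
  rw [hsq, Real.sqrt_sq n.cast_nonneg, Complex.ofReal_natCast,
    ← eq_inv_of_mul_eq_one_left hcn]
  exact congr_fun hc x

end Orbit

/-- abstract orbit method for finite groups: under hypotheses (i) and (ii),
the assignment `Ω ↦ χ_Ω` is a well-defined bijection from the set of `G`-orbits in `ĝ`
onto the set of irreducible characters of `G`. -/
theorem abstract_orbit_method_finite
    {G g : Type*} [Group G] [Fintype G] [AddCommGroup g] [Fintype g]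
    (exp : g ≃ G) (Ad : G → g ≃+ g)
    -- (i) each `Ad a` is the additive automorphism `x ↦ log (a * exp x * a⁻¹)`
    (hAd : ∀ (a : G) (x : g), Ad a x = exp.symm (a * exp x * a⁻¹))
    -- (ii) pullback along `exp` intertwines the two normalized convolutions on class functions
    (hconv : ∀ F₁ F₂ : G → ℂ, IsClassFun F₁ → IsClassFun F₂ →
      (fun x => convG F₁ F₂ (exp x)) = convA (fun x => F₁ (exp x)) (fun x => F₂ (exp x))) :
    (∀ Ω : Set (g → ℂ), IsOrbit Ad Ω → IsIrredChar (chiOrb exp Ω)) ∧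
    (∀ Ω Ω' : Set (g → ℂ), IsOrbit Ad Ω → IsOrbit Ad Ω' →
      chiOrb exp Ω = chiOrb exp Ω' → Ω = Ω') ∧
    (∀ χ : G → ℂ, IsIrredChar χ → ∃ Ω : Set (g → ℂ), IsOrbit Ad Ω ∧ chiOrb exp Ω = χ) := by
  classical
  have hexp (a : G) (x : g) : exp (Ad a x) = a * exp x * a⁻¹ := by
    rw [hAd, Equiv.apply_symm_apply]
  have hone (x : g) : Ad 1 x = x := exp.injective (by simp [hexp])
  have hmul (a b : G) (x : g) : Ad (a * b) x = Ad a (Ad b x) :=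
    exp.injective (by simp [hexp, mul_assoc])
  have hcard (ψ : AddChar g ℂ) : ((Real.sqrt (coadjointOrbit Ad ψ).card : ℂ))⁻¹ ≠ 0 := by
    have : 0 < (coadjointOrbit Ad ψ).card :=
      Finset.card_pos.2 ⟨ψ, mem_coadjointOrbit_self hone hmul⟩
    exact inv_ne_zero (by exact_mod_cast (Real.sqrt_pos.2 (by exact_mod_cast this)).ne')
  have hmem {ψ θ : AddChar g ℂ} (h : addCharCoeff (fun x ↦
      ((Real.sqrt (coadjointOrbit Ad θ).card : ℂ))⁻¹ * ∑ φ ∈ coadjointOrbit Ad θ, φ x) ψ ≠ 0) :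
      coadjointOrbit Ad ψ = coadjointOrbit Ad θ := by
    rw [addCharCoeff_sum] at h
    exact coadjointOrbit_eq_of_mem hone hmul (by_contra fun h' ↦ h (if_neg h'))
  refine ⟨fun Ω hΩ ↦ ?_, fun Ω Ω' hΩ hΩ' h ↦ ?_, ?_⟩
  · obtain ⟨ψ, rfl⟩ := isOrbit_iff.1 hΩ
    have hclass := isClassFun_sum_coadjointOrbit hone hmul hexp ψ
    have hF0 : (fun γ ↦ ∑ φ ∈ coadjointOrbit Ad ψ, φ (-exp.symm γ)) ≠ 0 := fun h0 ↦ by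
      have hne : (coadjointOrbit Ad ψ).Nonempty := ⟨ψ, mem_coadjointOrbit_self hone hmul⟩
      simpa [hne.ne_empty] using congr_fun h0 (exp 0)
    obtain ⟨n, ρ, hρ, hne⟩ := exists_repIrred_sum_smul_ne_zero hF0
    obtain ⟨θ, hθ⟩ := hρ.exists_trace_eq_sum_coadjointOrbit hone hmul hexp hconv
    have htr := hρ.natCast_smul_eq_trace_smul_one (sum_smul_mul_comm ρ hclass)
    simp only [Matrix.trace_sum, Matrix.trace_smul, smul_eq_mul] at htr
    rw [sum_sum_addChar_mul exp _ fun h ↦ (ρ h).val.trace] at htr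
    have hsum : ∑ φ ∈ coadjointOrbit Ad ψ,
        addCharCoeff (fun x ↦ (ρ (exp x)).val.trace) φ ≠ 0 := fun h0 ↦ by
      rw [h0, zero_smul] at htr
      exact (smul_ne_zero (by exact_mod_cast hρ.1.ne') hne) htr
    obtain ⟨φ, hφ, hφ0⟩ := Finset.exists_ne_zero_of_sum_ne_zero hsum
    simp only [hθ] at hφ0
    refine ⟨n, ρ, hρ, fun γ ↦ ?_⟩
    rw [chiOrb_image, ← coadjointOrbit_eq_of_mem hone hmul hφ, hmem hφ0]
    exact (hθ (exp.symm γ)).symm.trans (by rw [Equiv.apply_symm_apply])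
  · obtain ⟨ψ, rfl⟩ := isOrbit_iff.1 hΩ
    obtain ⟨θ, rfl⟩ := isOrbit_iff.1 hΩ'
    rw [chiOrb_image, chiOrb_image] at h
    have h' := funext fun x ↦ congr_fun h (exp x)
    simp only [Equiv.symm_apply_apply] at h'
    rw [hmem (ψ := ψ) (θ := θ)]
    rw [← h', addCharCoeff_sum, if_pos (mem_coadjointOrbit_self hone hmul)]
    exact mul_ne_zero (hcard ψ) (by exact_mod_cast Fintype.card_ne_zero)
  · rintro χ ⟨n, ρ, hρ, hχ⟩
    obtain ⟨ψ, hψ⟩ := hρ.exists_trace_eq_sum_coadjointOrbit hone hmul hexp hconv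
    refine ⟨_, isOrbit_iff.2 ⟨ψ, rfl⟩, ?_⟩
    rw [chiOrb_image]
    funext γ
    rw [hχ, ← exp.apply_symm_apply γ, hψ, Equiv.symm_apply_apply]
end

section
/- Let G be a finite group, g a finite abelian additive group, and exp : g → G a bijection with inverse log satisfying: (i) for each a ∈ G the map Ad a : x ↦ log(a · exp(x) · a⁻¹) is additive; (ii) for all class functions F₁, F₂ : G → ℂ, (F₁ * F₂) ∘ exp = (F₁ ∘ exp) ⋆ (F₂ ∘ exp) for the normalized convolutions. Then for every orbit Ω of the G-action on ĝ given by (a · f)(x) = f((Ad a)⁻¹(x)), the cardinality |Ω| is a perfect square: there is an irreducible complex representation ρ of G whose character χ satisfies χ(exp x) = |Ω|^{−1/2} ∑_{f ∈ Ω} f(x) for all x ∈ g, and |Ω| = (dim ρ)². -/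
section Representations

variable {G V : Type*} [Group G] [AddCommGroup V] [Module ℂ V]

theorem Subrepresentation.exists_isIrreducible_le [FiniteDimensional ℂ V]
    {ρ : Representation ℂ G V} (P : Subrepresentation ρ) (hP : P.toSubmodule ≠ ⊥) :
    ∃ S : Subrepresentation ρ, S.toSubmodule ≤ P.toSubmodule ∧
      S.toRepresentation.IsIrreducible := by
  obtain ⟨S, ⟨hSP, hS⟩, hmin⟩ := (measure fun S : Subrepresentation ρ =>
    Module.finrank ℂ S.toSubmodule).wf.has_min
      {S | S.toSubmodule ≤ P.toSubmodule ∧ S.toSubmodule ≠ ⊥} ⟨P, le_rfl, hP⟩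
  refine ⟨S, hSP, ?_⟩
  have : Nontrivial S.toSubmodule := Submodule.nontrivial_iff_ne_bot.2 hS
  refine { exists_pair_ne := ⟨⊥, ⊤, fun h => ?_⟩, eq_bot_or_eq_top := fun U => ?_ }
  · exact bot_ne_top (α := Submodule ℂ S.toSubmodule)
      (congrArg Subrepresentation.toSubmodule h)
  · by_contra! hU
    obtain ⟨hbot, htop⟩ := hU
    have hbot' : U.toSubmodule ≠ ⊥ := fun h => hbot (Subrepresentation.toSubmodule_injective h)
    have htop' : U.toSubmodule ≠ ⊤ := fun h => htop (Subrepresentation.toSubmodule_injective h)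
    let U' : Subrepresentation ρ :=
      { toSubmodule := U.toSubmodule.map S.toSubmodule.subtype
        apply_mem_toSubmodule := by
          rintro γ _ ⟨w, hw, rfl⟩
          exact ⟨S.toRepresentation γ w, U.apply_mem_toSubmodule γ hw, rfl⟩ }
    refine hmin U' ⟨(Submodule.map_subtype_le _ _).trans hSP, ?_⟩ ?_
    · exact fun h => hbot' <|
        Submodule.map_injective_of_injective S.toSubmodule.subtype_injective
          (h.trans (Submodule.map_bot _).symm)
    · change Module.finrank ℂ (U.toSubmodule.map S.toSubmodule.subtype) < _
      rw [Submodule.finrank_map_subtype_eq]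
      exact Submodule.finrank_lt htop'

theorem Representation.IsIrreducible.exists_matrix [FiniteDimensional ℂ V]
    (σ : Representation ℂ G V) [σ.IsIrreducible] :
    ∃ (n : ℕ) (ρ : G →* Matrix.GeneralLinearGroup (Fin n) ℂ), RepIrred ρ ∧
      ∀ γ, Matrix.trace (ρ γ).val = σ.character γ := by
  let b := Module.finBasis ℂ V
  let M : G →* Matrix (Fin (Module.finrank ℂ V)) (Fin (Module.finrank ℂ V)) ℂ :=
    ((LinearMap.toMatrixAlgEquiv b : _ →* _)).comp σ
  have hM (γ : G) : M γ = LinearMap.toMatrix b b (σ γ) := rfl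
  refine ⟨_, M.toHomUnits, ⟨?_, fun W hW => ?_⟩, fun γ => ?_⟩
  · rw [Module.finrank_pos_iff]
    by_contra h
    rw [not_nontrivial_iff_subsingleton] at h
    exact bot_ne_top (α := Subrepresentation σ)
      (Subrepresentation.toSubmodule_injective (Subsingleton.elim _ _))
  · let e : V ≃ₗ[ℂ] (Fin (Module.finrank ℂ V) → ℂ) := b.equivFun
    let U : Subrepresentation σ :=
      { toSubmodule := W.comap e.toLinearMap
        apply_mem_toSubmodule := by
          intro γ v hv
          have h := hW γ _ hv
          rw [MonoidHom.coe_toHomUnits, hM] at h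
          change e (σ γ v) ∈ W
          convert h using 1
          exact (LinearMap.toMatrix_mulVec_repr b b (σ γ) v).symm }
    have hU : W = U.toSubmodule.map e.toLinearMap :=
      (Submodule.map_comap_eq_of_surjective e.surjective W).symm
    rcases eq_bot_or_eq_top U with h | h
    · left
      rw [hU, h]
      exact Submodule.map_bot _
    · right
      rw [hU, h]
      exact (Submodule.map_top _).trans e.range
  · rw [MonoidHom.coe_toHomUnits, hM, Representation.character, LinearMap.trace_eq_matrix_trace ℂ b]

/-- The right regular representation on functions, `(γ · φ)(x) = φ(x γ)`. -/
def rightRegular (G : Type*) [Group G] : Representation ℂ G (G → ℂ) where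
  toFun γ := LinearMap.funLeft ℂ ℂ (· * γ)
  map_one' := by ext; simp [LinearMap.funLeft_apply]
  map_mul' a b := by ext; simp [LinearMap.funLeft_apply, mul_assoc]

variable [Fintype G]

/-- The operator by which convolution with `E` acts on a representation: it satisfies
`tr (averageOp E ρ ∘ ρ γ) = (E * tr ρ)(γ)`. -/
noncomputable def averageOp (E : G → ℂ) (ρ : Representation ℂ G V) : V →ₗ[ℂ] V :=
  (Fintype.card G : ℂ)⁻¹ • ∑ h : G, E h • ρ h⁻¹

theorem averageOp_comm {E : G → ℂ} (hE : IsClassFun E) (ρ : Representation ℂ G V) (γ : G) (v : V) :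
    averageOp E ρ (ρ γ v) = ρ γ (averageOp E ρ v) := by
  simp only [averageOp, LinearMap.smul_apply, LinearMap.sum_apply, map_smul, map_sum]
  congr 1
  rw [← (MulAut.conj γ).toEquiv.sum_comp]
  refine Finset.sum_congr rfl fun h _ => ?_
  change E (γ * h * γ⁻¹) • ρ (γ * h * γ⁻¹)⁻¹ (ρ γ v) = _
  rw [hE γ h]
  simp [← Module.End.mul_apply, ← map_mul, mul_assoc]

theorem trace_averageOp_mul (E : G → ℂ) (ρ : Representation ℂ G V) (γ : G) :
    LinearMap.trace ℂ V (averageOp E ρ * ρ γ) = convG E ρ.character γ := by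
  simp [averageOp, convG, Finset.sum_mul, Representation.character]

theorem averageOp_rightRegular {E : G → ℂ} (hE : IsClassFun E) (x : G) :
    averageOp E (rightRegular G) E x = convG E E x := by
  have h (γ : G) : E (x * γ⁻¹) = E (γ⁻¹ * x) := by
    simpa [mul_assoc] using hE γ (γ⁻¹ * x)
  simp [averageOp, convG, rightRegular, LinearMap.funLeft_apply, h]

theorem exists_repIrred_of_convG_self {E : G → ℂ} (hE : IsClassFun E) (hE0 : E ≠ 0)
    (hEE : convG E E = E) :
    ∃ (n : ℕ) (ρ : G →* Matrix.GeneralLinearGroup (Fin n) ℂ), RepIrred ρ ∧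
      convG E (fun γ => Matrix.trace (ρ γ).val) = (fun γ => Matrix.trace (ρ γ).val) ∧
      convG (fun γ => Matrix.trace (ρ γ).val) (fun γ => Matrix.trace (ρ γ).val) 1 = 1 := by
  let P : Subrepresentation (rightRegular G) :=
    { toSubmodule := LinearMap.eqLocus (averageOp E (rightRegular G)) LinearMap.id
      apply_mem_toSubmodule := by
        intro γ v hv
        rw [LinearMap.mem_eqLocus] at hv ⊢
        rw [averageOp_comm hE, hv]
        rfl }
  have hP : P.toSubmodule ≠ ⊥ := by
    refine Submodule.ne_bot_iff _ |>.2 ⟨E, ?_, hE0⟩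
    change averageOp E (rightRegular G) E = E
    ext x
    rw [averageOp_rightRegular hE, hEE]
  obtain ⟨S, hSP, hS⟩ := P.exists_isIrreducible_le hP
  obtain ⟨n, ρ, hρ, hχ⟩ := Representation.IsIrreducible.exists_matrix S.toRepresentation
  have hop : averageOp E S.toRepresentation = 1 := by
    ext1 w
    apply Subtype.ext
    have h : averageOp E (rightRegular G) w = w := hSP w.2
    refine Eq.trans ?_ h
    simp [averageOp, Subrepresentation.toRepresentation]
  refine ⟨n, ρ, hρ, ?_, ?_⟩
  · simp only [hχ]
    ext γ
    rw [← trace_averageOp_mul, hop, one_mul, Representation.character]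
  · simp only [hχ, convG, mul_one]
    have : Invertible (Nat.card G : ℂ) := invertibleOfNonzero (by simp)
    have h := Representation.char_orthonormal S.toRepresentation S.toRepresentation
    rw [if_pos ⟨Representation.Equiv.refl _⟩, Nat.card_eq_fintype_card] at h
    exact h

end Representations

section Abelian

variable {g : Type*} [AddCommGroup g]

theorem IsAddCharFun.comp {f : g → ℂ} (hf : IsAddCharFun f) (A : g ≃+ g) :
    IsAddCharFun fun x => f (A x) :=
  ⟨by simp [hf.1], fun x y => by simp [hf.2]⟩

variable [Fintype g]

theorem IsAddCharFun.inv_card_mul_sum_neg_mul [DecidableEq (g → ℂ)] {f f' : g → ℂ}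
    (hf : IsAddCharFun f) (hf' : IsAddCharFun f') :
    (Fintype.card g : ℂ)⁻¹ * ∑ y, f (-y) * f' y = if f = f' then 1 else 0 := by
  classical
  have hinv (x : g) : f (-x) * f x = 1 := by rw [← hf.2, neg_add_cancel, hf.1]
  let ψ : AddChar g ℂ :=
    { toFun := fun y => f (-y) * f' y
      map_zero_eq_one' := by simp [hf.1, hf'.1]
      map_add_eq_mul' := fun x y => by rw [neg_add, hf.2, hf'.2]; ring }
  have hψ : ψ = 0 ↔ f = f' := by
    rw [AddChar.eq_zero_iff, funext_iff]
    refine forall_congr' fun x => ?_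
    change f (-x) * f' x = 1 ↔ _
    constructor
    · intro h
      exact mul_left_cancel₀ (left_ne_zero_of_mul_eq_one (hinv x)) ((hinv x).trans h.symm)
    · intro h
      rw [← h, hinv]
  have h := AddChar.sum_eq_ite ψ
  simp only [hψ] at h
  change _ * ∑ y, ψ y = _
  rw [h]
  split_ifs <;> simp

theorem convA_sum_left (T : Finset (g → ℂ)) (hT : ∀ f ∈ T, IsAddCharFun f) (u : g → ℂ) (z : g) :
    convA (fun x => ∑ f ∈ T, f x) u z =
      ∑ f ∈ T, ((Fintype.card g : ℂ)⁻¹ * ∑ y, f (-y) * u y) * f z := by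
  have h : convA (fun x => ∑ f ∈ T, f x) u z =
      ∑ f ∈ T, (Fintype.card g : ℂ)⁻¹ * ∑ x, f x * u (z - x) := by
    simp only [convA, Finset.sum_mul]
    rw [Finset.sum_comm, Finset.mul_sum]
  rw [h]
  refine Finset.sum_congr rfl fun f hf => ?_
  rw [mul_assoc, Finset.sum_mul, ← (Equiv.subLeft z).sum_comp]
  congr 1
  refine Finset.sum_congr rfl fun y _ => ?_
  rw [Equiv.subLeft_apply, sub_sub_cancel, sub_eq_add_neg, (hT f hf).2]
  ring

theorem convA_sum_self (T : Finset (g → ℂ)) (hT : ∀ f ∈ T, IsAddCharFun f) :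
    convA (fun x => ∑ f ∈ T, f x) (fun x => ∑ f ∈ T, f x) = fun x => ∑ f ∈ T, f x := by
  classical
  ext z
  rw [convA_sum_left T hT]
  refine Finset.sum_congr rfl fun f hf => ?_
  have h : (Fintype.card g : ℂ)⁻¹ * ∑ y, f (-y) * ∑ f' ∈ T, f' y =
      ∑ f' ∈ T, (Fintype.card g : ℂ)⁻¹ * ∑ y, f (-y) * f' y := by
    simp only [Finset.mul_sum]
    rw [Finset.sum_comm]
  rw [h, Finset.sum_congr rfl fun f' hf' => (hT f hf).inv_card_mul_sum_neg_mul (hT f' hf')]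
  simp [hf]

end Abelian

section OrbitMethod

variable {G g : Type*} [Group G] [AddCommGroup g] {exp : g ≃ G} {Ad : G → g ≃+ g}

theorem isClassFun_comp_symm (hAd : ∀ (a : G) (x : g), Ad a x = exp.symm (a * exp x * a⁻¹))
    {u : g → ℂ} (hu : ∀ a x, u (Ad a x) = u x) : IsClassFun fun γ => u (exp.symm γ) := by
  intro h γ
  simpa [hAd] using hu h (exp.symm γ)

variable [Fintype G] [Fintype g]

theorem convG_comp_symm (hconv : ∀ F₁ F₂ : G → ℂ, IsClassFun F₁ → IsClassFun F₂ →
      (fun x => convG F₁ F₂ (exp x)) = convA (fun x => F₁ (exp x)) (fun x => F₂ (exp x)))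
    {F₁ F₂ : G → ℂ} (h₁ : IsClassFun F₁) (h₂ : IsClassFun F₂) (γ : G) :
    convG F₁ F₂ γ = convA (fun x => F₁ (exp x)) (fun x => F₂ (exp x)) (exp.symm γ) := by
  simpa using congrFun (hconv F₁ F₂ h₁ h₂) (exp.symm γ)

theorem exp_zero_eq_one (hAd : ∀ (a : G) (x : g), Ad a x = exp.symm (a * exp x * a⁻¹))
    (hconv : ∀ F₁ F₂ : G → ℂ, IsClassFun F₁ → IsClassFun F₂ →
      (fun x => convG F₁ F₂ (exp x)) = convA (fun x => F₁ (exp x)) (fun x => F₂ (exp x))) :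
    exp 0 = 1 := by
  classical
  have h₁ : IsClassFun (Pi.single (1 : G) (1 : ℂ)) := fun h γ => by
    simp [Pi.single_apply]
  have h₂ : IsClassFun (Pi.single (exp 0) (1 : ℂ)) := fun h γ => by
    have h0 : h * exp 0 * h⁻¹ = exp 0 := by
      rw [← exp.symm_apply_eq, ← hAd, map_zero]
    have : h * γ * h⁻¹ = exp 0 ↔ γ = exp 0 := by
      nth_rewrite 1 [← h0]
      simp
    simp [Pi.single_apply, this]
  have h := convG_comp_symm hconv h₁ h₂ (exp 0)
  by_contra hne
  have hz : ∀ x : g, (Pi.single (1 : G) (1 : ℂ) : G → ℂ) (exp x) *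
      (Pi.single (exp 0) (1 : ℂ) : G → ℂ) (exp (0 - x)) = 0 := by
    intro x
    rcases eq_or_ne x 0 with rfl | hx
    · simp [hne]
    · simp [Pi.single_apply, hx]
  simp only [convA, Equiv.symm_apply_apply, hz] at h
  simp [convG, Pi.single_apply] at h

theorem exists_repIrred_of_orbit
    (hAd : ∀ (a : G) (x : g), Ad a x = exp.symm (a * exp x * a⁻¹))
    (hconv : ∀ F₁ F₂ : G → ℂ, IsClassFun F₁ → IsClassFun F₂ →
      (fun x => convG F₁ F₂ (exp x)) = convA (fun x => F₁ (exp x)) (fun x => F₂ (exp x)))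
    {T : Finset (g → ℂ)} (hT : ∀ f ∈ T, IsAddCharFun f) (hne : T.Nonempty)
    (hinv : ∀ a, ∀ f ∈ T, (fun x => f (Ad a x)) ∈ T)
    (htrans : ∀ f ∈ T, ∀ f' ∈ T, ∃ a, f' = fun x => f (Ad a x)) :
    ∃ (n : ℕ) (ρ : G →* Matrix.GeneralLinearGroup (Fin n) ℂ), RepIrred ρ ∧
      (∀ x : g, Matrix.trace (ρ (exp x)).val = ((Real.sqrt T.card : ℂ))⁻¹ * ∑ f ∈ T, f x) ∧
      T.card = n ^ 2 := by
  classical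
  have hexp := exp_zero_eq_one hAd hconv
  have hT0 : ∑ f ∈ T, f 0 = (T.card : ℂ) := by
    rw [Finset.sum_congr rfl fun f hf => (hT f hf).1]
    simp
  have hTinv : ∀ a x, ∑ f ∈ T, f (Ad a x) = ∑ f ∈ T, f x := by
    intro a x
    have hinj : Set.InjOn (fun (f : g → ℂ) x => f (Ad a x)) T := fun f _ f' _ h => by
      funext y
      simpa using congrFun h ((Ad a).symm y)
    have himage : T.image (fun (f : g → ℂ) x => f (Ad a x)) = T :=
      Finset.eq_of_subset_of_card_le (Finset.image_subset_iff.2 (hinv a))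
        (Finset.card_image_of_injOn hinj).ge
    conv_rhs => rw [← himage, Finset.sum_image hinj]
  set E : G → ℂ := fun γ => ∑ f ∈ T, f (exp.symm γ) with hEdef
  have hEexp : (fun x => E (exp x)) = fun x => ∑ f ∈ T, f x := by simp [hEdef]
  have hE : IsClassFun E := isClassFun_comp_symm (u := fun x => ∑ f ∈ T, f x) hAd hTinv
  have hE1 : E 1 = T.card := by simp [hEdef, ← hexp, hT0]
  have hcard : (T.card : ℂ) ≠ 0 := Nat.cast_ne_zero.2 hne.card_ne_zero
  have hEE : convG E E = E := by
    ext γ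
    rw [convG_comp_symm hconv hE hE, hEexp, convA_sum_self T hT]
  obtain ⟨n, ρ, hρ, hEχ, hχχ⟩ := exists_repIrred_of_convG_self hE
    (fun h => hcard (hE1.symm.trans (congrFun h 1))) hEE
  set χ : G → ℂ := fun γ => Matrix.trace (ρ γ).val with hχdef
  have hχ : IsClassFun χ := fun h γ => by
    simp only [hχdef, map_mul, Units.val_mul]
    rw [Matrix.trace_mul_comm, ← Matrix.mul_assoc, ← Units.val_mul, ← map_mul]
    simp
  have hχ1 : χ 1 = n := by simp [hχdef]
  obtain ⟨f₀, hf₀⟩ := hne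
  obtain ⟨c, hc⟩ : ∃ c : ℂ, ∀ γ, χ γ = c * E γ := by
    refine ⟨(Fintype.card g : ℂ)⁻¹ * ∑ y, f₀ (-y) * χ (exp y), fun γ => ?_⟩
    rw [← congrFun hEχ γ, convG_comp_symm hconv hE hχ, hEexp, convA_sum_left T hT, hEdef,
      Finset.mul_sum]
    refine Finset.sum_congr rfl fun f hf => ?_
    congr 2
    obtain ⟨a, rfl⟩ := htrans f₀ hf₀ f hf
    refine Fintype.sum_equiv (Ad a).toEquiv _ _ fun y => ?_
    change f₀ (Ad a (-y)) * _ = f₀ (-(Ad a y)) * χ (exp (Ad a y))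
    rw [map_neg, hAd, Equiv.apply_symm_apply, hχ]
  have hcn : (n : ℂ) = c * T.card := by rw [← hχ1, hc, hE1]
  have hcc : c ^ 2 * T.card = 1 := by
    rw [← hχχ, ← hE1, ← congrFun hEE 1]
    simp only [convG, hc, Finset.mul_sum]
    refine Finset.sum_congr rfl fun h _ => ?_
    ring
  have hTn : T.card = n ^ 2 := by
    have h : (T.card : ℂ) = (n : ℂ) ^ 2 := by
      rw [hcn]
      linear_combination (-(T.card : ℂ)) * hcc
    exact_mod_cast h
  refine ⟨n, ρ, hρ, fun x => ?_, hTn⟩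
  have hsqrt : Real.sqrt T.card = n := by
    rw [hTn, Nat.cast_pow, Real.sqrt_sq n.cast_nonneg]
  have hn : (n : ℂ) ≠ 0 := Nat.cast_ne_zero.2 hρ.1.ne'
  have hcinv : c = (n : ℂ)⁻¹ := by
    rw [hTn, Nat.cast_pow] at hcn
    field_simp
    exact mul_right_cancel₀ hn (by linear_combination -hcn)
  rw [hsqrt, Complex.ofReal_natCast, ← hcinv, ← congrFun hEexp x]
  exact hc (exp x)

end OrbitMethod

/-- under hypotheses (i) and (ii) of the abstract orbit method for a finite
group `G`, the cardinality of every `G`-orbit `Ω` in `ĝ` is a perfect square: there is an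
irreducible representation `ρ` of `G` (of some dimension `n`) whose character satisfies
Kirillov's formula for `Ω`, and `|Ω| = n² = (dim ρ)²`. -/
theorem orbit_card_is_square
    {G g : Type*} [Group G] [Fintype G] [AddCommGroup g] [Fintype g]
    (exp : g ≃ G) (Ad : G → g ≃+ g)
    (hAd : ∀ (a : G) (x : g), Ad a x = exp.symm (a * exp x * a⁻¹))
    (hconv : ∀ F₁ F₂ : G → ℂ, IsClassFun F₁ → IsClassFun F₂ →
      (fun x => convG F₁ F₂ (exp x)) = convA (fun x => F₁ (exp x)) (fun x => F₂ (exp x))) :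
    ∀ Ω : Set (g → ℂ), IsOrbit Ad Ω →
      ∃ (n : ℕ) (ρ : G →* Matrix.GeneralLinearGroup (Fin n) ℂ), RepIrred ρ ∧
        (∀ x : g, Matrix.trace (ρ (exp x)).val
            = ((Real.sqrt (Nat.card ↥Ω) : ℂ))⁻¹ * ∑ᶠ f ∈ Ω, f x) ∧
        Nat.card ↥Ω = n ^ 2 := by
  classical
  rintro Ω ⟨f, hf, rfl⟩
  have hmul (a b : G) (x : g) : Ad (a * b) x = Ad a (Ad b x) := by
    simp [hAd, mul_assoc]
  have hone (x : g) : Ad 1 x = x := by simp [hAd]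
  have hsymm (a : G) (x : g) : (Ad a).symm x = Ad a⁻¹ x := by
    rw [AddEquiv.symm_apply_eq, ← hmul, mul_inv_cancel, hone]
  let T : Finset (g → ℂ) := Finset.univ.image fun a : G => fun x => f (Ad a x)
  have hΩ : { f' | ∃ a : G, f' = fun x => f ((Ad a).symm x) } = (T : Set (g → ℂ)) := by
    ext f'
    simp only [hsymm, Set.mem_ofPred_eq, T, Finset.coe_image, Finset.coe_univ, Set.image_univ,
      Set.mem_range]
    exact ⟨fun ⟨a, h⟩ => ⟨a⁻¹, h.symm⟩, fun ⟨a, h⟩ => ⟨a⁻¹, by rw [inv_inv, h]⟩⟩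
  rw [hΩ]
  simp only [finsum_mem_coe_finset, Nat.card_eq_card_toFinset, Finset.toFinset_coe]
  refine exists_repIrred_of_orbit hAd hconv ?_ ⟨_, Finset.mem_image_of_mem _ (Finset.mem_univ 1)⟩
    ?_ ?_
  · simp only [T, Finset.mem_image, Finset.mem_univ, true_and]
    rintro _ ⟨a, rfl⟩
    exact hf.comp (Ad a)
  · simp only [T, Finset.mem_image, Finset.mem_univ, true_and]
    rintro a _ ⟨b, rfl⟩
    exact ⟨b * a, by simp only [hmul]⟩
  · simp only [T, Finset.mem_image, Finset.mem_univ, true_and]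
    rintro _ ⟨a, rfl⟩ _ ⟨b, rfl⟩
    exact ⟨a⁻¹ * b, by simp only [← hmul, mul_inv_cancel_left]⟩
end

section
/- Let L be a nilpotent Lie ring (a Lie algebra over ℤ) with upper central series 0 = Z₀ ⊆ Z₁ ⊆ Z₂ ⊆ ⋯ (so Z₁ is the center of L and Z_{i+1}/Z_i is the center of L/Z_i). Let A, B : L × L → L be maps such that: (a) A(x,y) and B(x,y) lie in the derived subalgebra ⁅L, L⁆ for all x, y ∈ L; and (b) for every i ≥ 0, all x, y ∈ L and all z, w ∈ Z_{i+1}, one has A(x+z, y+w) − A(x,y) ∈ Z_i and B(x+z, y+w) − B(x,y) ∈ Z_i. Then the map L × L → L × L, (x, y) ↦ (x + A(x,y), y + B(x,y)), is injective; if moreover L is finite, it is bijective. -/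
/-- The derived subalgebra `⁅L, L⁆` of a Lie ring, as the additive subgroup generated by
all brackets. -/
def derivedSubgroup (L : Type*) [LieRing L] : AddSubgroup L :=
  AddSubgroup.closure { z : L | ∃ u v : L, z = ⁅u, v⁆ }

/-- let `L` be a nilpotent Lie ring with upper central series `Z` (so
`Z 0 = 0`, and `Z (i+1)` consists of the elements whose bracket with everything lies in
`Z i`), and let `A B : L × L → L` take values in `⁅L, L⁆` and change only by an element of
`Z i` when their arguments are translated by elements of `Z (i+1)`. Then the map
`(x, y) ↦ (x + A(x,y), y + B(x,y))` is injective, and bijective if `L` is finite. -/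
theorem CH_twist_map_injective
    {L : Type*} [LieRing L]
    (Z : ℕ → AddSubgroup L)
    (hZ0 : Z 0 = ⊥)
    (hZsucc : ∀ i : ℕ, ∀ x : L, x ∈ Z (i + 1) ↔ ∀ y : L, ⁅x, y⁆ ∈ Z i)
    (hnil : ∃ n : ℕ, Z n = ⊤)
    (A B : L → L → L)
    (hA : ∀ x y : L, A x y ∈ derivedSubgroup L)
    (hB : ∀ x y : L, B x y ∈ derivedSubgroup L)
    (hAZ : ∀ i : ℕ, ∀ x y z w : L, z ∈ Z (i + 1) → w ∈ Z (i + 1) →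
      A (x + z) (y + w) - A x y ∈ Z i)
    (hBZ : ∀ i : ℕ, ∀ x y z w : L, z ∈ Z (i + 1) → w ∈ Z (i + 1) →
      B (x + z) (y + w) - B x y ∈ Z i) :
    Function.Injective (fun p : L × L => (p.1 + A p.1 p.2, p.2 + B p.1 p.2)) ∧
    (Finite L →
      Function.Bijective (fun p : L × L => (p.1 + A p.1 p.2, p.2 + B p.1 p.2))) := by
  have hinj : Function.Injective (fun p : L × L => (p.1 + A p.1 p.2, p.2 + B p.1 p.2)) := by
    rintro ⟨x, y⟩ ⟨x', y'⟩ h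
    obtain ⟨h₁, h₂⟩ := Prod.mk.inj h
    obtain ⟨n, hn⟩ := hnil
    have descend : ∀ i, x - x' ∈ Z i ∧ y - y' ∈ Z i → x - x' ∈ Z 0 ∧ y - y' ∈ Z 0 := by
      intro i
      induction i with
      | zero => exact id
      | succ i ih =>
        rintro ⟨hx, hy⟩
        have hA' := hAZ i x' y' _ _ hx hy
        have hB' := hBZ i x' y' _ _ hx hy
        rw [add_sub_cancel, add_sub_cancel] at hA' hB'
        have ex : x - x' = -(A x y - A x' y') := by
          rw [neg_sub, sub_eq_sub_iff_add_eq_add, h₁, add_comm]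
        have ey : y - y' = -(B x y - B x' y') := by
          rw [neg_sub, sub_eq_sub_iff_add_eq_add, h₂, add_comm]
        exact ih ⟨ex ▸ neg_mem hA', ey ▸ neg_mem hB'⟩
    have h₀ := descend n (by simp [hn])
    rw [hZ0, AddSubgroup.mem_bot, AddSubgroup.mem_bot, sub_eq_zero, sub_eq_zero] at h₀
    exact Prod.ext h₀.1 h₀.2
  exact ⟨hinj, fun _ => Finite.injective_iff_bijective.mp hinj⟩
end

section
/- Let G be a finite group, g a finite abelian additive group, and exp : g → G a bijection. Suppose there exists a bijection T : g × g → g × g such that for all (x, y) ∈ g × g, writing T(x, y) = (x̃, ỹ): exp(x̃) is conjugate in G to exp(x), exp(ỹ) is conjugate in G to exp(y), and exp(x) · exp(y) = exp(x̃ + ỹ). Then for all class functions F₁, F₂ : G → ℂ one has (F₁ * F₂) ∘ exp = (F₁ ∘ exp) ⋆ (F₂ ∘ exp), where (F₁ * F₂)(γ) = |G|⁻¹ ∑_{h ∈ G} F₁(h) F₂(h⁻¹ γ) and (u ⋆ v)(z) = |g|⁻¹ ∑_{x ∈ g} u(x) v(z − x). -/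
lemma IsClassFun.eq_of_isConj {G : Type*} [Group G] {F : G → ℂ} (hF : IsClassFun F) {a b : G}
    (h : IsConj a b) : F a = F b := by
  obtain ⟨c, rfl⟩ := isConj_iff.1 h
  exact (hF c a).symm

open Classical in
/-- The unnormalized convolution on a group as a sum over the pairs with product `γ`. -/
lemma sum_mul_inv_mul_eq_sum_prod {G : Type*} [Group G] [Fintype G] (F₁ F₂ : G → ℂ) (γ : G) :
    ∑ h : G, F₁ h * F₂ (h⁻¹ * γ) =
      ∑ q : G × G, if q.1 * q.2 = γ then F₁ q.1 * F₂ q.2 else 0 := by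
  simp [Fintype.sum_prod_type, ← eq_inv_mul_iff_mul_eq]

open Classical in
/-- The unnormalized convolution on an additive group as a sum over the pairs with sum `z`. -/
lemma sum_mul_sub_eq_sum_prod {g : Type*} [AddCommGroup g] [Fintype g] (u v : g → ℂ) (z : g) :
    ∑ x : g, u x * v (z - x) =
      ∑ q : g × g, if q.1 + q.2 = z then u q.1 * v q.2 else 0 := by
  simp [Fintype.sum_prod_type, ← eq_sub_iff_add_eq']

/-- if there is a bijection `T : g × g → g × g`, `T(x,y) = (x̃, ỹ)`, with
`exp x̃` conjugate to `exp x`, `exp ỹ` conjugate to `exp y`, and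
`exp x · exp y = exp (x̃ + ỹ)`, then the pullback along `exp` intertwines the normalized
convolution of class functions on `G` with the normalized convolution on `g`. -/
theorem conv_compat_of_CH_decomposition
    {G g : Type*} [Group G] [Fintype G] [AddCommGroup g] [Fintype g]
    (exp : g ≃ G) (T : g × g → g × g) (hT : Function.Bijective T)
    (hconj₁ : ∀ x y : g, IsConj (exp x) (exp (T (x, y)).1))
    (hconj₂ : ∀ x y : g, IsConj (exp y) (exp (T (x, y)).2))
    (hsum : ∀ x y : g, exp x * exp y = exp ((T (x, y)).1 + (T (x, y)).2)) :
    ∀ F₁ F₂ : G → ℂ, IsClassFun F₁ → IsClassFun F₂ →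
      (fun z => convG F₁ F₂ (exp z)) = convA (fun x => F₁ (exp x)) (fun x => F₂ (exp x)) := by
  classical
  intro F₁ F₂ h₁ h₂
  funext z
  simp only [convG, convA]
  rw [sum_mul_inv_mul_eq_sum_prod,
    sum_mul_sub_eq_sum_prod (fun x => F₁ (exp x)) (fun x => F₂ (exp x)),
    Fintype.card_congr exp, ← (exp.prodCongr exp).sum_comp]
  congr 1
  refine Fintype.sum_bijective T hT _ _ fun ⟨x, y⟩ => ?_
  simp [hsum, h₁.eq_of_isConj (hconj₁ x y), h₂.eq_of_isConj (hconj₂ x y)]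
end
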